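/- For every multiindex n ∈ ℕ^d, the generalized formal powers satisfy L(u₀ X̃_{2n}) = 2|n|(2|n|−1) · Σ_{i=1}^d Rᵢ[u₀ X̃_{2n−2δᵢ}] on [x₁, x₂]. -/

import Mathlib

open Set in
/-- Fundamental theorem of calculus on a closed interval, with one-sided derivatives at the
endpoints. -/
theorem ContinuousOn.hasDerivWithinAt_integral_Icc {a b c : ℝ} {f : ℝ → ℂ}
    (hf : ContinuousOn f (Icc a b)) (hc : c ∈ Icc a b) {x : ℝ} (hx : x ∈ Icc a b) :
    HasDerivWithinAt (fun y => ∫ t in c..y, f t) (f x) (Icc a b) x := by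
  have hab : a ≤ b := hc.1.trans hc.2
  have hF : Continuous (IccExtend hab ((Icc a b).domRestrict f)) :=
    (continuousOn_iff_continuous_domRestrict.mp hf).Icc_extend'
  have heq : ∀ y ∈ Icc a b, IccExtend hab ((Icc a b).domRestrict f) y = f y := fun y hy => by
    rw [IccExtend_of_mem hab _ hy, domRestrict_apply]
  have h := (hF.integral_hasStrictDerivAt c x).hasDerivAt.hasDerivWithinAt (s := Icc a b)
  rw [heq x hx] at h
  have hint : ∀ y ∈ Icc a b, ∫ t in c..y, f t =
      ∫ t in c..y, IccExtend hab ((Icc a b).domRestrict f) t := fun y hy =>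
    intervalIntegral.integral_congr fun t ht =>
      (heq t (uIcc_subset_Icc hc hy ht)).symm
  exact h.congr hint (hint x hx)

/-- A function with a continuous derivative within a set of unique differentiability is `C¹`. -/
theorem ContinuousOn.contDiffOn_one_of_hasDerivWithinAt {I : Set ℝ} (hI : UniqueDiffOn ℝ I)
    {f g : ℝ → ℂ} (hg : ContinuousOn g I) (hf : ∀ x ∈ I, HasDerivWithinAt f (g x) I x) :
    ContDiffOn ℝ 1 f I := by
  rw [← zero_add (1 : WithTop ℕ∞), contDiffOn_succ_iff_derivWithin hI]
  refine ⟨fun x hx => (hf x hx).differentiableWithinAt, by simp, contDiffOn_zero.mpr ?_⟩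
  exact hg.congr fun x hx => (hf x hx).derivWithin (hI x hx)

/-- If `(p u′)′ + q u = 0` with `p`, `u` nonvanishing, `X′ = c S / (p u²)` and `S′ = u T`, then
`(p (u X)′)′ + q u X = c T`. -/
theorem sturmLiouville_mul_eq_of_hasDerivWithinAt {I : Set ℝ} (hI : UniqueDiffOn ℝ I)
    {p q u X S T : ℝ → ℂ} {c : ℂ}
    (hp : ContDiffOn ℝ 1 p I) (hpne : ∀ x ∈ I, p x ≠ 0)
    (hu : ContDiffOn ℝ 2 u I) (hune : ∀ x ∈ I, u x ≠ 0)
    (hsol : ∀ x ∈ I, derivWithin (fun t => p t * derivWithin u I t) I x + q x * u x = 0)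
    (hX : ∀ x ∈ I, HasDerivWithinAt X (c * (1 / (p x * u x ^ 2) * S x)) I x)
    (hS : ∀ x ∈ I, HasDerivWithinAt S (u x * T x) I x) {x : ℝ} (hx : x ∈ I) :
    derivWithin (fun t => p t * derivWithin (fun w => u w * X w) I t) I x + q x * (u x * X x)
      = c * T x := by
  have hu' : ∀ t ∈ I, HasDerivWithinAt u (derivWithin u I t) I t := fun t ht =>
    (hu.differentiableOn (by norm_num) t ht).hasDerivWithinAt
  have hdu : DifferentiableOn ℝ (derivWithin u I) I :=
    (hu.derivWithin hI (m := 1) (by norm_num)).differentiableOn (by norm_num)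
  have hpu : HasDerivWithinAt (fun t => p t * derivWithin u I t)
      (derivWithin (fun t => p t * derivWithin u I t) I x) I x :=
    ((hp.differentiableOn (by norm_num) x hx).mul (hdu x hx)).hasDerivWithinAt
  have hflux : ∀ t ∈ I, p t * derivWithin (fun w => u w * X w) I t =
      p t * derivWithin u I t * X t + c * (S t / u t) := fun t ht => by
    have h : derivWithin (fun w => u w * X w) I t = _ :=
      ((hu' t ht).mul (hX t ht)).derivWithin (hI t ht)
    rw [h]
    have := hpne t ht
    have := hune t ht
    field_simp
  have hd := (hpu.mul (hX x hx)).add (((hS x hx).div (hu' x hx) (hune x hx)).const_mul c)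
  have hval : derivWithin (fun t => p t * derivWithin (fun w => u w * X w) I t) I x = _ :=
    (hd.congr hflux (hflux x hx)).derivWithin (hI x hx)
  rw [hval]
  have hp0 := hpne x hx
  have hu0 := hune x hx
  rw [eq_neg_of_add_eq_zero_left (hsol x hx)]
  field_simp
  ring


/-- **Generalized lemma on `L(u₀ X̃_{2n})`.**  With `Rᵢ[y] = rᵢ y + sᵢ y′` and the generalized
SPPS formal powers `X̃_j` (here `Xt j`) defined by the recursion in the hypotheses, one has,
for every `n ∈ ℕ^d`,
`L(u₀ X̃_{2n}) = 2|n|(2|n|−1) Σᵢ Rᵢ[u₀ X̃_{2n−2δᵢ}]` on `[x₁, x₂]`,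
where `L y = (p y′)′ + q y` (derivatives within `[x₁, x₂]`). -/
theorem generalized_Lu0Xt_formula
    (d : ℕ) (hd : 1 ≤ d)
    (x₁ x₂ x₀ : ℝ) (hx : x₁ < x₂) (hx₀ : x₀ ∈ Set.Icc x₁ x₂)
    (p q u₀ : ℝ → ℂ) (r s : Fin d → ℝ → ℂ)
    (hp : ContDiffOn ℝ 1 p (Set.Icc x₁ x₂))
    (hq : ContinuousOn q (Set.Icc x₁ x₂))
    (hr : ∀ i, ContinuousOn (r i) (Set.Icc x₁ x₂))
    (hs : ∀ i, ContinuousOn (s i) (Set.Icc x₁ x₂))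
    (hpne : ∀ x ∈ Set.Icc x₁ x₂, p x ≠ 0)
    (hu₀ : ContDiffOn ℝ 2 u₀ (Set.Icc x₁ x₂))
    (hu₀ne : ∀ x ∈ Set.Icc x₁ x₂, u₀ x ≠ 0)
    (hu₀sol : ∀ x ∈ Set.Icc x₁ x₂,
      derivWithin (fun t => p t * derivWithin u₀ (Set.Icc x₁ x₂) t) (Set.Icc x₁ x₂) x
        + q x * u₀ x = 0)
    (Xt : (Fin d → ℤ) → ℝ → ℂ)
    (hXt0 : ∀ x, Xt 0 x = 1)
    (hXtneg : ∀ j : Fin d → ℤ, (∃ i, j i < 0) → ∀ x, Xt j x = 0)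
    (hXtodd : ∀ j : Fin d → ℤ, (∀ i, 0 ≤ j i) →
      (∀ i i', Odd (j i) → Odd (j i') → i = i') →
      ∀ i, Odd (j i) → ∀ x ∈ Set.Icc x₁ x₂,
        Xt j x = (((∑ i', j i') : ℤ) : ℂ) *
          ∫ t in x₀..x, u₀ t *
            (r i t * (u₀ t * Xt (j - Pi.single i 1) t) +
              s i t * derivWithin (fun w => u₀ w * Xt (j - Pi.single i 1) w)
                (Set.Icc x₁ x₂) t))
    (hXteven : ∀ j : Fin d → ℤ, (∀ i, 0 ≤ j i) →
      (∀ i i', Odd (j i) → Odd (j i') → i = i') →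
      Even (∑ i, j i) → j ≠ 0 → ∀ x ∈ Set.Icc x₁ x₂,
        Xt j x = (((∑ i, j i) : ℤ) : ℂ) *
          ∫ t in x₀..x, (1 / (p t * u₀ t ^ 2)) * ∑ i, Xt (j - Pi.single i 1) t) :
    ∀ n : Fin d → ℕ, ∀ x ∈ Set.Icc x₁ x₂,
      derivWithin (fun t => p t *
          derivWithin (fun w => u₀ w * Xt (fun i => (2 * n i : ℤ)) w) (Set.Icc x₁ x₂) t)
          (Set.Icc x₁ x₂) x
        + q x * (u₀ x * Xt (fun i => (2 * n i : ℤ)) x)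
      = (2 * ∑ i, (n i : ℂ)) * (2 * ∑ i, (n i : ℂ) - 1) *
          ∑ i, (r i x * (u₀ x * Xt ((fun i' => (2 * n i' : ℤ)) - Pi.single i 2) x) +
            s i x * derivWithin
              (fun w => u₀ w * Xt ((fun i' => (2 * n i' : ℤ)) - Pi.single i 2) w)
              (Set.Icc x₁ x₂) x) := by
  set I := Set.Icc x₁ x₂
  have hI : UniqueDiffOn ℝ I := uniqueDiffOn_Icc hx
  have hu₁ : ContDiffOn ℝ 1 u₀ I := hu₀.of_le (by norm_num)
  have hzero : ∀ j : Fin d → ℤ, (∃ i, j i < 0) → Xt j = fun _ => 0 := fun j hj =>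
    funext (hXtneg j hj)
  have hone : (Xt fun _ => 2 * 0) = fun _ => 1 := by
    simp only [mul_zero]
    exact funext hXt0
  have hRcont : ∀ (i : Fin d) (X : ℝ → ℂ), ContDiffOn ℝ 1 X I → ContinuousOn (fun t =>
      r i t * (u₀ t * X t) + s i t * derivWithin (fun w => u₀ w * X w) I t) I := fun i X hX =>
    ((hr i).mul (hu₁.continuousOn.mul hX.continuousOn)).add
      ((hs i).mul ((hu₁.mul hX).continuousOn_derivWithin hI le_rfl))
  have hodd : ∀ (m : Fin d → ℤ) (i : Fin d),
      ContDiffOn ℝ 1 (Xt ((fun i' => 2 * m i') - Pi.single i 2)) I → ∀ x ∈ I,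
      HasDerivWithinAt (Xt ((fun i' => 2 * m i') - Pi.single i 1))
        ((2 * ∑ i', (m i' : ℂ) - 1) * (u₀ x *
          (r i x * (u₀ x * Xt ((fun i' => 2 * m i') - Pi.single i 2) x) +
            s i x * derivWithin
              (fun w => u₀ w * Xt ((fun i' => 2 * m i') - Pi.single i 2) w) I x))) I x := by
    intro m i hX x hxI
    by_cases hneg : ∃ i', ((fun i' => 2 * m i') - Pi.single i 1 : Fin d → ℤ) i' < 0
    · have hneg' : ∃ i', ((fun i' => 2 * m i') - Pi.single i 2 : Fin d → ℤ) i' < 0 := by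
        obtain ⟨k, hk⟩ := hneg
        refine ⟨k, lt_of_le_of_lt ?_ hk⟩
        rcases eq_or_ne k i with rfl | hki <;> simp [*]
      rw [hzero _ hneg, hzero _ hneg']
      simpa using hasDerivWithinAt_const x I (0 : ℂ)
    · push Not at hneg
      have hparity : ∀ k, Odd (((fun i' => 2 * m i') - Pi.single i 1 : Fin d → ℤ) k) → k = i := by
        intro k hk
        by_contra hki
        simp only [Pi.sub_apply, Pi.single_eq_of_ne hki, sub_zero] at hk
        exact absurd hk (by simp)
      have hoddi : Odd (((fun i' => 2 * m i') - Pi.single i 1 : Fin d → ℤ) i) := by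
        simp only [Pi.sub_apply, Pi.single_eq_same]
        exact ⟨m i - 1, by ring⟩
      have hprev : ((fun i' => 2 * m i') - Pi.single i 1 - Pi.single i 1 : Fin d → ℤ) =
          (fun i' => 2 * m i') - Pi.single i 2 := by
        rw [sub_sub, ← Pi.single_add]; rfl
      have hrec := hXtodd _ hneg
        (fun k k' hk hk' => (hparity k hk).trans (hparity k' hk').symm) i hoddi
      have hsum : ((∑ i', ((fun i' => 2 * m i') - Pi.single i 1 : Fin d → ℤ) i' : ℤ) : ℂ) =
          2 * ∑ i', (m i' : ℂ) - 1 := by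
        simp [Finset.sum_sub_distrib, Finset.mul_sum]
      rw [hprev, hsum] at hrec
      have hcont := hu₁.continuousOn.mul (hRcont i _ hX)
      exact ((hcont.hasDerivWithinAt_integral_Icc hx₀ hxI).const_mul _).congr hrec (hrec x hxI)
  have heven : ∀ m : Fin d → ℤ, (∀ i, 0 ≤ m i) → m ≠ 0 →
      (∀ i, ContDiffOn ℝ 1 (Xt ((fun i' => 2 * m i') - Pi.single i 2)) I) →
      ContinuousOn (fun t => (2 * ∑ i, (m i : ℂ)) *
        (1 / (p t * u₀ t ^ 2) * ∑ i, Xt ((fun i' => 2 * m i') - Pi.single i 1) t)) I ∧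
      ∀ x ∈ I, HasDerivWithinAt (Xt fun i => 2 * m i) ((2 * ∑ i, (m i : ℂ)) *
        (1 / (p x * u₀ x ^ 2) * ∑ i, Xt ((fun i' => 2 * m i') - Pi.single i 1) x)) I x := by
    intro m hm hm0 hX
    have hcont : ContinuousOn (fun t => 1 / (p t * u₀ t ^ 2) *
        ∑ i, Xt ((fun i' => 2 * m i') - Pi.single i 1) t) I :=
      (continuousOn_const.div (hp.continuousOn.mul (hu₀.continuousOn.pow 2)) fun t ht =>
        mul_ne_zero (hpne t ht) (pow_ne_zero 2 (hu₀ne t ht))).mul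
        (continuousOn_finsetSum _ fun i _ t ht =>
          (hodd m i (hX i) t ht).continuousWithinAt)
    refine ⟨continuousOn_const.mul hcont, fun x hxI => ?_⟩
    have hrec := hXteven (fun i => 2 * m i) (fun i => by have := hm i; positivity)
      (fun i _ hi => absurd hi (by simp)) (by rw [← Finset.mul_sum]; simp)
      (fun h => hm0 (funext fun i => by simpa using congrFun h i))
    have hsum : ((∑ i, 2 * m i : ℤ) : ℂ) = 2 * ∑ i, (m i : ℂ) := by
      simp [Finset.mul_sum]
    rw [hsum] at hrec
    exact ((hcont.hasDerivWithinAt_integral_Icc hx₀ hxI).const_mul _).congr hrec (hrec x hxI)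
  have hpred : ∀ (m : Fin d → ℤ) (i : Fin d),
      ((fun i' => 2 * m i') - Pi.single i 2 : Fin d → ℤ) =
        fun i' => 2 * (m - Pi.single i 1 : Fin d → ℤ) i' := by
    intro m i
    funext k
    rcases eq_or_ne k i with rfl | hki
    · simp; ring
    · simp [hki]
  have hsmooth : ∀ (N : ℕ) (m : Fin d → ℤ), ∑ i, m i ≤ N →
      ContDiffOn ℝ 1 (Xt fun i => 2 * m i) I := by
    intro N
    induction N with
    | zero =>
      intro m hmN
      by_cases hm : ∀ i, 0 ≤ m i
      · have hm0 : ∀ i, m i = 0 := fun i =>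
          (Finset.sum_eq_zero_iff_of_nonneg fun i _ => hm i).mp
            (le_antisymm (by simpa using hmN) (Finset.sum_nonneg fun i _ => hm i))
            i (Finset.mem_univ i)
        simp only [hm0, hone]
        exact contDiffOn_const
      · push Not at hm
        rw [hzero _ (hm.imp fun i hi => by linarith)]
        exact contDiffOn_const
    | succ N ih =>
      intro m hmN
      by_cases hm : ∀ i, 0 ≤ m i
      · by_cases hm0 : m = 0
        · simp only [hm0, Pi.zero_apply, hone]
          exact contDiffOn_const
        · obtain ⟨hcont, hder⟩ := heven m hm hm0 fun i => by
            rw [hpred]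
            refine ih _ ?_
            push_cast at hmN
            simp only [Pi.sub_apply, Finset.sum_sub_distrib, Fintype.sum_pi_single']
            linarith
          exact hcont.contDiffOn_one_of_hasDerivWithinAt hI hder
      · push Not at hm
        rw [hzero _ (hm.imp fun i hi => by linarith)]
        exact contDiffOn_const
  intro n x hxI
  by_cases hn : n = 0
  · simp only [hn, Pi.zero_apply, Nat.cast_zero, hone]
    simpa using hu₀sol x hxI
  · have hX : ∀ i, ContDiffOn ℝ 1 (Xt ((fun i' => (2 * n i' : ℤ)) - Pi.single i 2)) I := by
      intro i
      rw [hpred fun i' => (n i' : ℤ)]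
      exact hsmooth _ _ (Int.self_le_toNat _)
    have hder := (heven (fun i => (n i : ℤ)) (fun i => by positivity)
      (fun h => hn (funext fun i => by simpa using congrFun h i)) hX).2
    have hS : ∀ t ∈ I, HasDerivWithinAt
        (fun t => ∑ i, Xt ((fun i' => (2 * n i' : ℤ)) - Pi.single i 1) t)
        (u₀ t * ((2 * ∑ i, (n i : ℂ) - 1) *
          ∑ i, (r i t * (u₀ t * Xt ((fun i' => (2 * n i' : ℤ)) - Pi.single i 2) t) +
            s i t * derivWithin
              (fun w => u₀ w * Xt ((fun i' => (2 * n i' : ℤ)) - Pi.single i 2) w) I t))) I t := by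
      intro t ht
      have h := HasDerivWithinAt.fun_sum (u := Finset.univ) fun i _ =>
        hodd (fun i => (n i : ℤ)) i (hX i) t ht
      rw [← Finset.mul_sum, ← Finset.mul_sum, mul_left_comm] at h
      simpa only [Int.cast_natCast] using h
    simp only [Int.cast_natCast] at hder
    rw [mul_assoc]
    exact sturmLiouville_mul_eq_of_hasDerivWithinAt hI hp hpne hu₀ hu₀ne hu₀sol hder hS hxI
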